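/- arXiv:2007.00666 — 7 statements merged into one kernel-verified Lean document; each statement's English description precedes it below -/
import Mathlib

section
/- Let R > 0 and define P : ℝ → ℝ by P(Φ) = exp(−Φ²/2) · h_R(Φ/√2). Then for every Φ > 0, the derivative of the function Φ ↦ Φ·P(Φ) + P'(Φ) at Φ equals R·P(Φ); i.e., P solves the stationary Fokker–Planck equation with stochastic resetting rate R, d/dΦ[V'(Φ)P(Φ) + P'(Φ)] = R·P(Φ), away from the resetting point Φ = 0, for the quadratic (paramagnetic) potential V(Φ) = Φ²/2. -/
open Real MeasureTheory Filter Topology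

/-- `hFun R x = ∫₀^∞ t^(R-1) exp(-t² - 2xt) dt`, i.e. `Γ(R) · H(-R, x)`. -/
noncomputable def hFun (R x : ℝ) : ℝ :=
  ∫ t in Set.Ioi (0 : ℝ), t ^ (R - 1) * Real.exp (-t ^ 2 - 2 * x * t)

/-- The high-temperature stationary profile `P(Φ) = exp(-Φ²/2) h_R(Φ/√2)`. -/
noncomputable def Pfun (R : ℝ) : ℝ → ℝ :=
  fun Φ => Real.exp (-Φ ^ 2 / 2) * hFun R (Φ / Real.sqrt 2)

theorem exp_neg_sq_sub_le {x c t : ℝ} (hx : |x| ≤ c) :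
    Real.exp (-t ^ 2 - 2 * x * t) ≤ Real.exp (2 * c ^ 2) * Real.exp (-(1 / 2) * t ^ 2) := by
  rw [← Real.exp_add, Real.exp_le_exp]
  have hsq : x ^ 2 ≤ c ^ 2 := sq_le_sq.mpr (hx.trans (le_abs_self c))
  nlinarith [sq_nonneg (t + 2 * x)]

theorem aestronglyMeasurable_rpow_mul_exp (s x : ℝ) :
    AEStronglyMeasurable (fun t : ℝ => t ^ s * Real.exp (-t ^ 2 - 2 * x * t))
      (volume.restrict (Set.Ioi 0)) := by
  apply Measurable.aestronglyMeasurable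
  fun_prop

theorem integrableOn_rpow_mul_exp_neg_sq_sub {s : ℝ} (hs : -1 < s) (x : ℝ) :
    IntegrableOn (fun t : ℝ => t ^ s * Real.exp (-t ^ 2 - 2 * x * t)) (Set.Ioi 0) := by
  refine Integrable.mono' ((integrableOn_rpow_mul_exp_neg_mul_sq one_half_pos hs).const_mul
    (Real.exp (2 * |x| ^ 2))) (aestronglyMeasurable_rpow_mul_exp s x) ?_
  filter_upwards [ae_restrict_mem measurableSet_Ioi] with t ht
  have hts : 0 ≤ t ^ s := Real.rpow_nonneg (le_of_lt ht) s
  rw [Real.norm_of_nonneg (by positivity), mul_left_comm]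
  exact mul_le_mul_of_nonneg_left (exp_neg_sq_sub_le le_rfl) hts

theorem hasDerivAt_hFun {R : ℝ} (hR : 0 < R) (x : ℝ) :
    HasDerivAt (hFun R) (-2 * hFun (R + 1) x) x := by
  have key := (hasDerivAt_integral_of_dominated_loc_of_deriv_le (𝕜 := ℝ)
    (μ := volume.restrict (Set.Ioi (0 : ℝ))) (s := Metric.ball x 1) (x₀ := x)
    (F := fun y t : ℝ => t ^ (R - 1) * Real.exp (-t ^ 2 - 2 * y * t))
    (F' := fun y t : ℝ => -2 * (t ^ R * Real.exp (-t ^ 2 - 2 * y * t)))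
    (bound := fun t : ℝ => 2 * (Real.exp (2 * (|x| + 1) ^ 2) *
      (t ^ R * Real.exp (-(1 / 2) * t ^ 2))))
    (Metric.ball_mem_nhds x one_pos)
    (Eventually.of_forall fun y => aestronglyMeasurable_rpow_mul_exp (R - 1) y)
    (integrableOn_rpow_mul_exp_neg_sq_sub (by linarith) x)
    ((aestronglyMeasurable_rpow_mul_exp R x).const_mul (-2)) ?_
    (((integrableOn_rpow_mul_exp_neg_mul_sq one_half_pos (by linarith)).const_mul _).const_mul 2)
    ?_).2
  · rw [integral_const_mul] at key
    simpa only [hFun, add_sub_cancel_right] using! key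
  · filter_upwards [ae_restrict_mem measurableSet_Ioi] with t ht y hy
    have htR : 0 ≤ t ^ R := Real.rpow_nonneg (le_of_lt ht) R
    have hyc : |y| ≤ |x| + 1 := by
      have hdist : |y - x| < 1 := by simpa [Real.dist_eq] using hy
      linarith [abs_sub_abs_le_abs_sub y x]
    rw [norm_mul, Real.norm_of_nonneg (by positivity : 0 ≤ t ^ R * _), norm_neg,
      Real.norm_ofNat, mul_left_comm (Real.exp _)]
    gcongr
    exact exp_neg_sq_sub_le hyc
  · filter_upwards [ae_restrict_mem measurableSet_Ioi] with t ht y _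
    have hexponent : HasDerivAt (fun y : ℝ => -t ^ 2 - 2 * y * t) (-(2 * t)) y := by
      simpa using! (((hasDerivAt_id y).const_mul 2).mul_const t).const_sub (-t ^ 2)
    refine (hexponent.exp.const_mul (t ^ (R - 1))).congr_deriv ?_
    have hpow : t ^ R = t ^ (R - 1) * t := by
      rw [← Real.rpow_add_one (ne_of_gt ht), sub_add_cancel]
    rw [hpow]
    ring

/-- Integration of `d/dt (t^R exp(-t² - 2xt))` over the half-line. -/
theorem two_mul_hFun_add_two {R : ℝ} (hR : 0 < R) (x : ℝ) :
    2 * hFun (R + 2) x + 2 * x * hFun (R + 1) x = R * hFun R x := by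
  have h₀ := (integrableOn_rpow_mul_exp_neg_sq_sub (s := R - 1) (by linarith) x).const_mul R
  have h₁ := (integrableOn_rpow_mul_exp_neg_sq_sub (s := R + 1 - 1) (by linarith) x).const_mul
    (2 * x)
  have h₂ := (integrableOn_rpow_mul_exp_neg_sq_sub (s := R + 2 - 1) (by linarith) x).const_mul 2
  have hderiv : ∀ t ∈ Set.Ioi (0 : ℝ),
      HasDerivAt (fun t : ℝ => t ^ R * Real.exp (-t ^ 2 - 2 * x * t))
        (R * (t ^ (R - 1) * Real.exp (-t ^ 2 - 2 * x * t))
          - 2 * x * (t ^ (R + 1 - 1) * Real.exp (-t ^ 2 - 2 * x * t))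
          - 2 * (t ^ (R + 2 - 1) * Real.exp (-t ^ 2 - 2 * x * t))) t := by
    intro t ht
    have hexponent : HasDerivAt (fun t : ℝ => -t ^ 2 - 2 * x * t) (-(2 * t) - 2 * x) t := by
      simpa using! (hasDerivAt_pow 2 t).neg.sub ((hasDerivAt_id t).const_mul (2 * x))
    refine ((Real.hasDerivAt_rpow_const (Or.inl (ne_of_gt ht))).mul hexponent.exp).congr_deriv ?_
    have hpow : t ^ (R + 2 - 1) = t ^ R * t := by
      rw [← Real.rpow_add_one (ne_of_gt ht)]
      ring_nf
    rw [hpow, add_sub_cancel_right]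
    ring
  have hint := (h₀.sub h₁).sub h₂
  have hcont : ContinuousWithinAt (fun t : ℝ => t ^ R * Real.exp (-t ^ 2 - 2 * x * t))
      (Set.Ici 0) 0 := by
    have hc := Real.continuous_rpow_const hR.le
    exact Continuous.continuousWithinAt (by fun_prop)
  have key := (integral_sub (h₀.sub h₁) h₂).symm.trans
    (integral_Ioi_of_hasDerivAt_of_tendsto hcont hderiv hint
      (tendsto_zero_of_hasDerivAt_of_integrableOn_Ioi hderiv hint
        (integrableOn_rpow_mul_exp_neg_sq_sub (by linarith) x)))
  rw [integral_sub' h₀ h₁, integral_const_mul, integral_const_mul,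
    integral_const_mul, Real.zero_rpow hR.ne'] at key
  simp only [hFun]
  linarith

theorem hasDerivAt_Pfun {R : ℝ} (hR : 0 < R) (Φ : ℝ) :
    HasDerivAt (Pfun R) (-Φ * Pfun R Φ - Real.sqrt 2 * Pfun (R + 1) Φ) Φ := by
  have hgauss : HasDerivAt (fun Ψ : ℝ => -Ψ ^ 2 / 2) (-Φ) Φ :=
    ((hasDerivAt_pow 2 Φ).neg.div_const 2).congr_deriv (by push_cast; ring)
  have hh : HasDerivAt (fun Ψ : ℝ => hFun R (Ψ / Real.sqrt 2))
      (-2 * hFun (R + 1) (Φ / Real.sqrt 2) * (1 / Real.sqrt 2)) Φ :=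
    HasDerivAt.comp (h₂ := hFun R) Φ (hasDerivAt_hFun hR (Φ / Real.sqrt 2))
      ((hasDerivAt_id' Φ).div_const (Real.sqrt 2))
  refine (hgauss.exp.mul hh).congr_deriv ?_
  have hsqrt : 2 * (1 / Real.sqrt 2) = Real.sqrt 2 := by
    rw [mul_one_div, Real.div_sqrt]
  simp only [Pfun]
  linear_combination (-(Real.exp (-Φ ^ 2 / 2) * hFun (R + 1) (Φ / Real.sqrt 2))) * hsqrt

/-- For `R > 0` and `P(Φ) = exp(-Φ²/2) h_R(Φ/√2)`, for every `Φ > 0` the derivative of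
`Φ ↦ Φ·P(Φ) + P'(Φ)` at `Φ` equals `R·P(Φ)`: `P` solves the stationary Fokker–Planck
equation with resetting rate `R` away from `Φ = 0`, for the potential `V(Φ) = Φ²/2`. -/
theorem stationary_FP_high_temperature (R : ℝ) (hR : 0 < R) :
    ∀ Φ : ℝ, 0 < Φ →
      HasDerivAt (fun Ψ : ℝ => Ψ * Pfun R Ψ + deriv (Pfun R) Ψ) (R * Pfun R Φ) Φ := by
  intro Φ _
  have hflux : (fun Ψ : ℝ => Ψ * Pfun R Ψ + deriv (Pfun R) Ψ) =
      fun Ψ => -Real.sqrt 2 * Pfun (R + 1) Ψ := by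
    funext Ψ
    rw [(hasDerivAt_Pfun hR Ψ).deriv]
    ring
  rw [hflux]
  refine ((hasDerivAt_Pfun (by linarith : 0 < R + 1) Φ).const_mul
    (-Real.sqrt 2)).congr_deriv ?_
  have hrec := two_mul_hFun_add_two hR (Φ / Real.sqrt 2)
  have hsq : Real.sqrt 2 * Real.sqrt 2 = 2 := Real.mul_self_sqrt zero_le_two
  have hx : 2 * (Φ / Real.sqrt 2) = Real.sqrt 2 * Φ := by
    field_simp
    linarith
  rw [hx] at hrec
  rw [show R + 1 + 1 = R + 2 by ring]
  simp only [Pfun]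
  linear_combination Real.exp (-Φ ^ 2 / 2) * hrec +
    Real.exp (-Φ ^ 2 / 2) * hFun (R + 2) (Φ / Real.sqrt 2) * hsq
end

section
/- For every real R > 0, the Gamma-function ratio satisfies the two-sided bound R − 1/2 < 2·(Γ((1+R)/2)/Γ(R/2))² ≤ R. Consequently, the quadratic coefficient a₂ = (1−R)/2 + (Γ((1+R)/2)/Γ(R/2))² of the high-temperature non-equilibrium Landau potential satisfies 1/4 < a₂ ≤ 1/2 for all R > 0. -/
open Real

/-- Log-convexity of the Gamma function at a midpoint. -/
lemma Gamma_add_half_sq_le {x : ℝ} (hx : 0 < x) :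
    Gamma (x + 1 / 2) ^ 2 ≤ x * Gamma x ^ 2 := by
  have h := Gamma_mul_add_mul_le_rpow_Gamma_mul_rpow_Gamma (s := x) (t := x + 1)
    (a := 1 / 2) (b := 1 / 2) hx (by linarith) (by norm_num) (by norm_num) (by norm_num)
  have e : 1 / 2 * x + 1 / 2 * (x + 1) = x + 1 / 2 := by ring
  rw [e, ← sqrt_eq_rpow, ← sqrt_eq_rpow] at h
  have h1 : 0 < Gamma x := Gamma_pos_of_pos hx
  have h2 : 0 < Gamma (x + 1) := Gamma_pos_of_pos (by linarith)
  have h3 : 0 < Gamma (x + 1 / 2) := Gamma_pos_of_pos (by linarith)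
  calc Gamma (x + 1 / 2) ^ 2 ≤ (√(Gamma x) * √(Gamma (x + 1))) ^ 2 := by gcongr
    _ = Gamma x * Gamma (x + 1) := by rw [mul_pow, sq_sqrt h1.le, sq_sqrt h2.le]
    _ = x * Gamma x ^ 2 := by rw [Gamma_add_one hx.ne']; ring

/-- The squared Gamma ratio `(Γ(x + 1/2) / Γ(x))²`. -/
noncomputable def gammaRatioSq (x : ℝ) : ℝ := (Gamma (x + 1 / 2) / Gamma x) ^ 2

lemma gammaRatioSq_pos {x : ℝ} (hx : 0 < x) : 0 < gammaRatioSq x := by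
  have h1 : 0 < Gamma x := Gamma_pos_of_pos hx
  have h3 : 0 < Gamma (x + 1 / 2) := Gamma_pos_of_pos (by linarith)
  unfold gammaRatioSq
  positivity

lemma gammaRatioSq_le {x : ℝ} (hx : 0 < x) : gammaRatioSq x ≤ x := by
  have h1 : 0 < Gamma x := Gamma_pos_of_pos hx
  rw [gammaRatioSq, div_pow, div_le_iff₀ (by positivity)]
  exact Gamma_add_half_sq_le hx

lemma sq_div_le_gammaRatioSq {x : ℝ} (hx : 0 < x) :
    x ^ 2 / (x + 1 / 2) ≤ gammaRatioSq x := by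
  have h1 : 0 < Gamma x := Gamma_pos_of_pos hx
  have h := Gamma_add_half_sq_le (x := x + 1 / 2) (by linarith)
  rw [show x + 1 / 2 + 1 / 2 = x + 1 by ring, Gamma_add_one hx.ne'] at h
  rw [gammaRatioSq, div_pow, div_le_div_iff₀ (by positivity) (by positivity)]
  linarith [mul_pow x (Gamma x) 2]

lemma gammaRatioSq_add_one {x : ℝ} (hx : 0 < x) :
    gammaRatioSq (x + 1) = ((x + 1 / 2) / x) ^ 2 * gammaRatioSq x := by
  have h1 : Gamma x ≠ 0 := (Gamma_pos_of_pos hx).ne'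
  rw [gammaRatioSq, gammaRatioSq, show x + 1 + 1 / 2 = (x + 1 / 2) + 1 by ring,
    Gamma_add_one hx.ne', Gamma_add_one (by linarith : x + 1 / 2 ≠ 0), ← mul_pow,
    div_mul_div_comm]

lemma gammaRatioSq_div_add_one_lt {x : ℝ} (hx : 1 / 4 < x) :
    gammaRatioSq (x + 1) / (x + 1 - 1 / 4) < gammaRatioSq x / (x - 1 / 4) := by
  have h0 : 0 < x := by linarith
  have hq := gammaRatioSq_pos h0
  rw [gammaRatioSq_add_one h0, div_lt_div_iff₀ (by linarith) (by linarith), div_pow,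
    div_mul_eq_mul_div, div_mul_eq_mul_div, div_lt_iff₀ (by positivity)]
  nlinarith

lemma one_le_gammaRatioSq_div {x : ℝ} (hx : 1 / 4 < x) :
    1 ≤ gammaRatioSq x / (x - 1 / 4) := by
  have hanti : ∀ n : ℕ,
      gammaRatioSq (x + n) / (x + n - 1 / 4) ≤ gammaRatioSq x / (x - 1 / 4) := by
    intro n
    induction n with
    | zero => simp
    | succ n ih =>
      have hn : (0 : ℝ) ≤ n := n.cast_nonneg
      have h := gammaRatioSq_div_add_one_lt (x := x + n) (by linarith)
      push_cast
      rw [← add_assoc]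
      exact h.le.trans ih
  have hlim : Filter.Tendsto (fun n : ℕ => 1 - 1 * (1 / ((n : ℝ) + 1))) Filter.atTop
      (nhds (1 - 1 * 0)) :=
    (tendsto_one_div_add_atTop_nhds_zero_nat.const_mul 1).const_sub 1
  simp only [mul_zero, sub_zero, one_mul] at hlim
  refine le_of_tendsto hlim (Filter.Eventually.of_forall fun n => ?_)
  refine le_trans ?_ (hanti n)
  have hn : (0 : ℝ) ≤ n := n.cast_nonneg
  have hy : 0 < x + n := by linarith
  rw [le_div_iff₀ (by linarith)]
  refine le_trans ?_ (sq_div_le_gammaRatioSq hy)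
  rw [one_sub_div (by positivity), div_mul_eq_mul_div,
    div_le_div_iff₀ (by positivity) (by positivity)]
  have h : (n : ℝ) < x + n := by linarith
  nlinarith [mul_nonneg hn hy.le, mul_nonneg hn hn]

lemma sub_quarter_lt_gammaRatioSq {x : ℝ} (hx : 0 < x) : x - 1 / 4 < gammaRatioSq x := by
  rcases le_or_gt x (1 / 4) with h | h
  · linarith [gammaRatioSq_pos hx]
  · have h1 := (one_le_gammaRatioSq_div (x := x + 1) (by linarith)).trans_lt
      (gammaRatioSq_div_add_one_lt h)
    rwa [one_lt_div (by linarith)] at h1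

/-- For every `R > 0`, the Gamma-ratio bound `R - 1/2 < 2(Γ((1+R)/2)/Γ(R/2))² ≤ R` holds;
consequently the quadratic coefficient `a₂ = (1-R)/2 + (Γ((1+R)/2)/Γ(R/2))²` of the
high-temperature non-equilibrium Landau potential satisfies `1/4 < a₂ ≤ 1/2`. -/
theorem gamma_ratio_bounds_high_temperature (R : ℝ) (hR : 0 < R) :
    (R - 1 / 2 < 2 * (Real.Gamma ((1 + R) / 2) / Real.Gamma (R / 2)) ^ 2 ∧
      2 * (Real.Gamma ((1 + R) / 2) / Real.Gamma (R / 2)) ^ 2 ≤ R) ∧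
    (1 / 4 < (1 - R) / 2 + (Real.Gamma ((1 + R) / 2) / Real.Gamma (R / 2)) ^ 2 ∧
      (1 - R) / 2 + (Real.Gamma ((1 + R) / 2) / Real.Gamma (R / 2)) ^ 2 ≤ 1 / 2) := by
  have hx : 0 < R / 2 := by linarith
  have h1 := sub_quarter_lt_gammaRatioSq hx
  have h2 := gammaRatioSq_le hx
  rw [gammaRatioSq, show R / 2 + 1 / 2 = (1 + R) / 2 by ring] at h1 h2
  refine ⟨⟨?_, ?_⟩, ?_, ?_⟩ <;> linarith
end

section
/- For every real x, the ratio h_R(x)/h_R(0) tends to 1 as R → 0⁺, where h_R(x) = ∫₀^∞ t^(R−1) exp(−t² − 2xt) dt. Consequently, for every Φ, the high-temperature non-equilibrium Landau potential Φ²/2 − log(h_R(Φ/√2)/h_R(0)) converges pointwise to the equilibrium paramagnetic fixed-point potential Φ²/2 in the infrared limit R → 0⁺. -/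
open Real MeasureTheory Filter Topology

lemma abs_exp_sub_one_le_abs_mul_exp_abs (y : ℝ) : |Real.exp y - 1| ≤ |y| * Real.exp |y| := by
  have h1 := Real.add_one_le_exp (-y)
  have h2 := Real.add_one_le_exp y
  have h3 : Real.exp (-y) * Real.exp y = 1 := by rw [← Real.exp_add]; simp
  have h4 := Real.exp_pos y
  rcases le_total 0 y with hy | hy
  · rw [abs_of_nonneg hy, abs_of_nonneg (by linarith)]
    nlinarith
  · have h5 : 1 ≤ Real.exp (-y) := by linarith
    rw [abs_of_nonpos hy, abs_of_nonpos (by linarith [Real.exp_le_one_iff.2 hy])]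
    nlinarith

lemma integrable_exp_neg_sq_add_mul (b : ℝ) :
    Integrable (fun t : ℝ => Real.exp (-t ^ 2 + b * t)) := by
  refine ((integrable_exp_neg_mul_sq (b := 1 / 2) (by norm_num)).const_mul
    (Real.exp (b ^ 2 / 2))).mono' (by fun_prop) (ae_of_all _ fun t => ?_)
  rw [Real.norm_of_nonneg (Real.exp_pos _).le, ← Real.exp_add, Real.exp_le_exp]
  nlinarith [sq_nonneg (t - b)]

lemma integrableOn_hFun_zero {R : ℝ} (hR : 0 < R) :
    IntegrableOn (fun t : ℝ => t ^ (R - 1) * Real.exp (-t ^ 2 - 2 * 0 * t)) (Set.Ioi 0) := by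
  have h := integrableOn_rpow_mul_exp_neg_rpow (p := 2) (s := R - 1) (by linarith) (by norm_num)
  simpa using h

lemma hFun_zero {R : ℝ} (hR : 0 < R) : hFun R 0 = Real.Gamma (R / 2 + 1) / R := by
  have h := integral_rpow_mul_exp_neg_rpow (p := 2) (q := R - 1) (by norm_num) (by linarith)
  rw [Real.Gamma_add_one (by positivity), hFun]
  simp only [Real.rpow_ofNat, sub_add_cancel] at h
  simp only [mul_zero, zero_mul, sub_zero]
  rw [h]
  field_simp

lemma norm_hFun_integrand_sub_le {R t : ℝ} (hR : 0 < R) (hR1 : R ≤ 1) (ht : 0 < t) (x : ℝ) :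
    ‖t ^ (R - 1) * Real.exp (-t ^ 2 - 2 * x * t) - t ^ (R - 1) * Real.exp (-t ^ 2 - 2 * 0 * t)‖ ≤
      2 * |x| * Real.exp (-t ^ 2 + (2 * |x| + 1) * t) := by
  have hpow : t ^ R ≤ Real.exp t := by
    rw [Real.rpow_def_of_pos ht, Real.exp_le_exp]
    have hlog := Real.log_le_sub_one_of_pos ht
    rcases le_total 0 (Real.log t) with h | h <;> nlinarith
  have hfac : t ^ (R - 1) * Real.exp (-t ^ 2 - 2 * x * t)
      - t ^ (R - 1) * Real.exp (-t ^ 2 - 2 * 0 * t)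
      = t ^ (R - 1) * Real.exp (-t ^ 2) * (Real.exp (-(2 * x * t)) - 1) := by
    rw [sub_eq_add_neg (-t ^ 2) (2 * x * t), Real.exp_add]
    simp only [mul_zero, zero_mul, sub_zero]
    ring
  have habs : |-(2 * x * t)| = 2 * |x| * t := by
    rw [abs_neg, abs_mul, abs_mul, abs_of_pos ht, abs_two]
  have hexp := abs_exp_sub_one_le_abs_mul_exp_abs (-(2 * x * t))
  rw [habs] at hexp
  rw [hfac, Real.norm_eq_abs, abs_mul, abs_of_pos (by positivity)]
  calc t ^ (R - 1) * Real.exp (-t ^ 2) * |Real.exp (-(2 * x * t)) - 1|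
      ≤ t ^ (R - 1) * Real.exp (-t ^ 2) * (2 * |x| * t * Real.exp (2 * |x| * t)) := by gcongr
    _ = 2 * |x| * (t ^ R * (Real.exp (-t ^ 2) * Real.exp (2 * |x| * t))) := by
      rw [Real.rpow_sub_one ht.ne']; field_simp
    _ ≤ 2 * |x| * (Real.exp t * (Real.exp (-t ^ 2) * Real.exp (2 * |x| * t))) := by gcongr
    _ = 2 * |x| * Real.exp (-t ^ 2 + (2 * |x| + 1) * t) := by
      rw [← Real.exp_add, ← Real.exp_add]; ring_nf

lemma exists_abs_hFun_sub_hFun_zero_le (x : ℝ) :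
    ∃ C, ∀ R, 0 < R → R ≤ 1 → |hFun R x - hFun R 0| ≤ C := by
  refine ⟨∫ t in Set.Ioi (0 : ℝ), 2 * |x| * Real.exp (-t ^ 2 + (2 * |x| + 1) * t),
    fun R hR hR1 => ?_⟩
  have hdom : IntegrableOn (fun t : ℝ => 2 * |x| * Real.exp (-t ^ 2 + (2 * |x| + 1) * t))
      (Set.Ioi 0) := ((integrable_exp_neg_sq_add_mul _).const_mul _).integrableOn
  have hbound := (ae_restrict_iff' (μ := volume) measurableSet_Ioi).2
    (ae_of_all _ fun t (ht : t ∈ Set.Ioi (0 : ℝ)) => norm_hFun_integrand_sub_le hR hR1 ht x)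
  have h0 := integrableOn_hFun_zero hR
  have hx : IntegrableOn (fun t : ℝ => t ^ (R - 1) * Real.exp (-t ^ 2 - 2 * x * t))
      (Set.Ioi 0) := by
    have hsub := hdom.mono' (Measurable.aestronglyMeasurable (by fun_prop)) hbound
    exact (hsub.add h0).congr (ae_of_all _ fun t => by simp)
  rw [hFun, hFun, ← integral_sub hx h0, ← Real.norm_eq_abs]
  exact norm_integral_le_of_norm_le hdom hbound

lemma tendsto_hFun_div_hFun_zero (x : ℝ) :
    Tendsto (fun R => hFun R x / hFun R 0) (𝓝[>] (0 : ℝ)) (𝓝 1) := by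
  obtain ⟨C, hC⟩ := exists_abs_hFun_sub_hFun_zero_le x
  have hGamma : Tendsto (fun R : ℝ => Real.Gamma (R / 2 + 1)) (𝓝 0) (𝓝 1) := by
    have hcont : ContinuousAt Real.Gamma 1 :=
      (Real.differentiableAt_Gamma fun m => by
        have : (0 : ℝ) ≤ m := m.cast_nonneg
        linarith).continuousAt
    have hlin : Tendsto (fun R : ℝ => R / 2 + 1) (𝓝 0) (𝓝 1) :=
      Continuous.tendsto' (by fun_prop) _ _ (by norm_num)
    simpa [Real.Gamma_one, Function.comp_def] using hcont.tendsto.comp hlin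
  have hlim : Tendsto (fun R : ℝ => C * R / Real.Gamma (R / 2 + 1)) (𝓝[>] 0) (𝓝 0) := by
    have hnum : Tendsto (fun R : ℝ => C * R) (𝓝 0) (𝓝 0) :=
      Continuous.tendsto' (by fun_prop) _ _ (by simp)
    simpa [Pi.div_def] using (hnum.div hGamma one_ne_zero).mono_left nhdsWithin_le_nhds
  rw [tendsto_iff_norm_sub_tendsto_zero]
  refine squeeze_zero' (Eventually.of_forall fun _ => norm_nonneg _) ?_ hlim
  filter_upwards [Ioc_mem_nhdsGT (zero_lt_one (α := ℝ))] with R hR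
  have hG : 0 < Real.Gamma (R / 2 + 1) := Real.Gamma_pos_of_pos (by linarith [hR.1])
  have hpos : 0 < hFun R 0 := by rw [hFun_zero hR.1]; exact div_pos hG hR.1
  rw [div_sub_one hpos.ne', norm_div, Real.norm_eq_abs, Real.norm_of_nonneg hpos.le]
  calc |hFun R x - hFun R 0| / hFun R 0 ≤ C / hFun R 0 := by
        gcongr
        exact hC R hR.1 hR.2
    _ = C * R / Real.Gamma (R / 2 + 1) := by rw [hFun_zero hR.1, div_div_eq_mul_div]

/-- For every `x`, `h_R(x)/h_R(0) → 1` as `R → 0⁺`; consequently, for every `Φ`, the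
high-temperature non-equilibrium Landau potential `Φ²/2 - log(h_R(Φ/√2)/h_R(0))` converges
pointwise to the equilibrium paramagnetic fixed-point potential `Φ²/2` as `R → 0⁺`. -/
theorem high_temperature_infrared_limit :
    (∀ x : ℝ, Tendsto (fun R => hFun R x / hFun R 0) (𝓝[>] (0 : ℝ)) (𝓝 1)) ∧
    (∀ Φ : ℝ, Tendsto
      (fun R => Φ ^ 2 / 2 - Real.log (hFun R (Φ / Real.sqrt 2) / hFun R 0))
      (𝓝[>] (0 : ℝ)) (𝓝 (Φ ^ 2 / 2))) := by
  refine ⟨tendsto_hFun_div_hFun_zero, fun Φ => ?_⟩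
  simpa using ((tendsto_hFun_div_hFun_zero (Φ / Real.sqrt 2)).log one_ne_zero).const_sub (Φ ^ 2 / 2)
end

section
/- Let g(x) = exp(x²/2) · ∫_x^∞ exp(−t²/2) dt and define the infrared fixed-point potential V*(x) = −log g(x). Then V* is smooth in a neighborhood of 0 and: V*'(0) = √(2/π); V*''(0) = 2/π − 1; and V*'''(0) = (4 − π)·√2/π^(3/2). Equivalently, the one-sided expansion of the fixed-point potential reads V*(|Φ|) = V*(0) + √(2/π)|Φ| − (1/2 − 1/π)Φ² + ((4/π − 1)/(3√(2π)))|Φ|³ + o(|Φ|³). -/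
open Real MeasureTheory Filter Topology Asymptotics

/-- The infrared fixed-point profile `g(x) = e^(x²/2) ∫_x^∞ e^(-t²/2) dt`. -/
noncomputable def g (x : ℝ) : ℝ :=
  Real.exp (x ^ 2 / 2) * ∫ t in Set.Ioi x, Real.exp (-t ^ 2 / 2)

/-- The infrared fixed-point potential `V*(x) = -log g(x)`. -/
noncomputable def Vstar (x : ℝ) : ℝ := -Real.log (g x)

theorem integrable_exp_neg_sq_div_two : Integrable fun t : ℝ => Real.exp (-t ^ 2 / 2) := by
  convert integrable_exp_neg_mul_sq (b := 1 / 2) (by norm_num) using 3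
  ring

theorem hasDerivAt_gaussian_tail (x : ℝ) :
    HasDerivAt (fun y : ℝ => ∫ t in Set.Ioi y, Real.exp (-t ^ 2 / 2))
      (-Real.exp (-x ^ 2 / 2)) x := by
  have hcont : Continuous fun t : ℝ => Real.exp (-t ^ 2 / 2) := by fun_prop
  have htail : (fun y : ℝ => ∫ t in Set.Ioi y, Real.exp (-t ^ 2 / 2)) = fun y =>
      (∫ t in Set.Ioi (0 : ℝ), Real.exp (-t ^ 2 / 2)) - ∫ t in (0 : ℝ)..y, Real.exp (-t ^ 2 / 2) := by
    funext y
    rw [← intervalIntegral.integral_interval_add_Ioi (a := 0) (b := y)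
      integrable_exp_neg_sq_div_two.integrableOn integrable_exp_neg_sq_div_two.integrableOn]
    ring
  rw [htail]
  exact (intervalIntegral.integral_hasDerivAt_right (hcont.intervalIntegrable _ _)
    (hcont.stronglyMeasurableAtFilter _ _) hcont.continuousAt).const_sub _

theorem contDiff_gaussian_tail :
    ContDiff ℝ (⊤ : ℕ∞) fun y : ℝ => ∫ t in Set.Ioi y, Real.exp (-t ^ 2 / 2) := by
  rw [contDiff_infty_iff_deriv]
  refine ⟨fun x => (hasDerivAt_gaussian_tail x).differentiableAt, ?_⟩
  rw [funext fun x => (hasDerivAt_gaussian_tail x).deriv]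
  fun_prop

theorem g_pos (x : ℝ) : 0 < g x := by
  have : NeZero (volume.restrict (Set.Ioi x)) := ⟨by simp⟩
  exact mul_pos (Real.exp_pos _) (integral_exp_pos integrable_exp_neg_sq_div_two.integrableOn)

theorem contDiff_g : ContDiff ℝ (⊤ : ℕ∞) g := by
  have hexp : ContDiff ℝ (⊤ : ℕ∞) fun x : ℝ => Real.exp (x ^ 2 / 2) := by fun_prop
  exact hexp.mul contDiff_gaussian_tail

theorem contDiff_Vstar : ContDiff ℝ (⊤ : ℕ∞) Vstar :=
  (contDiff_g.log fun x => (g_pos x).ne').neg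

theorem g_zero : g 0 = Real.sqrt (π / 2) := by
  have h := integral_gaussian_Ioi (1 / 2)
  have hcongr : (fun t : ℝ => Real.exp (-t ^ 2 / 2)) = fun t => Real.exp (-(1 / 2) * t ^ 2) := by
    funext t
    congr 1
    ring
  rw [g, hcongr, h, show π / (1 / 2) = 2 ^ 2 * (π / 2) by ring,
    Real.sqrt_mul (by positivity), Real.sqrt_sq (by norm_num)]
  norm_num

theorem inv_g_zero : (g 0)⁻¹ = Real.sqrt (2 / π) := by
  rw [g_zero, ← Real.sqrt_inv, inv_div]

theorem hasDerivAt_g (x : ℝ) : HasDerivAt g (x * g x - 1) x := by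
  have hsq : HasDerivAt (fun y : ℝ => y ^ 2 / 2) x x := by
    simpa using (hasDerivAt_pow 2 x).div_const 2
  refine (hsq.exp.mul (hasDerivAt_gaussian_tail x)).congr_deriv ?_
  have hone : Real.exp (x ^ 2 / 2) * Real.exp (-x ^ 2 / 2) = 1 := by
    rw [← Real.exp_add, neg_div, add_neg_cancel, Real.exp_zero]
  rw [g]
  linear_combination -hone

theorem hasDerivAt_inv_g (x : ℝ) :
    HasDerivAt (fun y => (g y)⁻¹) ((g x)⁻¹ ^ 2 - x * (g x)⁻¹) x := by
  refine ((hasDerivAt_g x).inv (g_pos x).ne').congr_deriv ?_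
  have := (g_pos x).ne'
  field_simp
  ring

theorem deriv_Vstar : deriv Vstar = fun x => (g x)⁻¹ - x := by
  funext x
  refine HasDerivAt.deriv ((((hasDerivAt_g x).log (g_pos x).ne').neg).congr_deriv ?_)
  have := (g_pos x).ne'
  field_simp
  ring

theorem iteratedDeriv_two_Vstar :
    iteratedDeriv 2 Vstar = fun x => (g x)⁻¹ ^ 2 - x * (g x)⁻¹ - 1 := by
  rw [iteratedDeriv_succ, iteratedDeriv_one, deriv_Vstar]
  funext x
  exact ((hasDerivAt_inv_g x).sub (hasDerivAt_id x)).deriv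

theorem iteratedDeriv_three_Vstar_zero :
    iteratedDeriv 3 Vstar 0 = 2 * (g 0)⁻¹ ^ 3 - (g 0)⁻¹ := by
  rw [iteratedDeriv_succ, iteratedDeriv_two_Vstar]
  refine HasDerivAt.deriv (((((hasDerivAt_inv_g 0).pow 2).sub
    ((hasDerivAt_id 0).mul (hasDerivAt_inv_g 0))).sub_const 1).congr_deriv ?_)
  simp
  ring

theorem sqrt_two_div_pi_sq : Real.sqrt (2 / π) ^ 2 = 2 / π :=
  Real.sq_sqrt (by positivity)

theorem iteratedDeriv_three_Vstar_zero_eq :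
    iteratedDeriv 3 Vstar 0 = (4 / π - 1) * Real.sqrt (2 / π) := by
  rw [iteratedDeriv_three_Vstar_zero, inv_g_zero]
  linear_combination 2 * Real.sqrt (2 / π) * sqrt_two_div_pi_sq

theorem sqrt_two_div_pi_eq : Real.sqrt (2 / π) = 2 / Real.sqrt (2 * π) := by
  rw [eq_div_iff (by positivity), ← Real.sqrt_mul (by positivity),
    show 2 / π * (2 * π) = 2 ^ 2 by field_simp, Real.sqrt_sq (by norm_num)]

theorem Vstar_taylor_isLittleO :
    (fun x : ℝ => Vstar x -
        (Vstar 0 + Real.sqrt (2 / π) * x - (1 / 2 - 1 / π) * x ^ 2 +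
          (4 / π - 1) / (3 * Real.sqrt (2 * π)) * x ^ 3))
      =o[𝓝 0] fun x : ℝ => x ^ 3 := by
  have h := taylor_isLittleO_univ (x₀ := 0) (contDiff_infty.mp contDiff_Vstar 3)
  refine (h.congr_left fun x => ?_).congr_right fun x => by rw [sub_zero]
  simp only [taylor_within_apply, Finset.sum_range_succ, Finset.sum_range_zero,
    iteratedDerivWithin_univ, iteratedDeriv_three_Vstar_zero_eq]
  simp only [iteratedDeriv_two_Vstar, iteratedDeriv_one, deriv_Vstar, iteratedDeriv_zero,
    inv_g_zero, sqrt_two_div_pi_sq, smul_eq_mul]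
  norm_num [Nat.factorial]
  rw [show (4 / π - 1) / (3 * (√2 * √π)) = (4 / π - 1) * (√2 / √π) / 6 by
    have := sqrt_two_div_pi_eq
    simp only [Real.sqrt_mul (zero_le_two), Real.sqrt_div zero_le_two] at this
    rw [this]
    ring]
  ring

/-- `V* = -log g` is smooth near `0` with `V*'(0) = √(2/π)`, `V*''(0) = 2/π - 1`,
`V*'''(0) = (4-π)√2/π^(3/2)`; equivalently the one-sided expansion
`V*(|Φ|) = V*(0) + √(2/π)|Φ| - (1/2 - 1/π)Φ² + ((4/π-1)/(3√(2π)))|Φ|³ + o(|Φ|³)` holds. -/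
theorem fixed_point_potential_expansion :
    (∃ U ∈ 𝓝 (0 : ℝ), ContDiffOn ℝ (⊤ : ℕ∞) Vstar U) ∧
    deriv Vstar 0 = Real.sqrt (2 / π) ∧
    iteratedDeriv 2 Vstar 0 = 2 / π - 1 ∧
    iteratedDeriv 3 Vstar 0 = (4 - π) * Real.sqrt 2 / π ^ ((3 : ℝ) / 2) ∧
    (fun Φ : ℝ => Vstar |Φ| -
        (Vstar 0 + Real.sqrt (2 / π) * |Φ| - (1 / 2 - 1 / π) * Φ ^ 2 +
          (4 / π - 1) / (3 * Real.sqrt (2 * π)) * |Φ| ^ 3))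
      =o[𝓝 0] fun Φ : ℝ => |Φ| ^ 3 := by
  refine ⟨⟨Set.univ, univ_mem, contDiff_Vstar.contDiffOn⟩, ?_, ?_, ?_, ?_⟩
  · simp [deriv_Vstar, inv_g_zero]
  · rw [iteratedDeriv_two_Vstar]
    simp only [inv_g_zero, sqrt_two_div_pi_sq]
    ring
  · rw [iteratedDeriv_three_Vstar_zero_eq, Real.sqrt_div zero_le_two,
      show (3 : ℝ) / 2 = 1 + 1 / 2 by norm_num, Real.rpow_add pi_pos, Real.rpow_one,
      ← Real.sqrt_eq_rpow]
    field_simp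
  · have habs : Tendsto (fun x : ℝ => |x|) (𝓝 0) (𝓝 0) := by
      simpa using (continuous_abs (G := ℝ)).tendsto 0
    simpa [Function.comp_def, sq_abs] using Vstar_taylor_isLittleO.comp_tendsto habs
end

section
/- Let r > 0 and p(x) = (√r/2)·exp(−√r·|x|). Then for every smooth compactly supported test function φ : ℝ → ℝ, ∫_ℝ p(x)·φ''(x) dx − r·∫_ℝ p(x)·φ(x) dx + r·φ(0) = 0; i.e., p is a distributional stationary solution of the diffusion equation with stochastic resetting to the origin at rate r, 0 = p'' − r·p + r·δ. -/
open Real MeasureTheory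

section ExpMulAntiderivative

variable {φ : ℝ → ℝ} (c : ℝ)

lemma contDiff_exp_mul_deriv_sub (hφ : ContDiff ℝ 2 φ) :
    ContDiff ℝ 1 (fun x => Real.exp (c * x) * (deriv φ x - c * φ x)) := by
  have h1 : ContDiff ℝ 1 (deriv φ) := ContDiff.deriv' (n := 1) (by rwa [one_add_one_eq_two])
  have h0 : ContDiff ℝ 1 φ := hφ.of_le (by norm_num)
  fun_prop

lemma deriv_exp_mul_deriv_sub (hφ : ContDiff ℝ 2 φ) (x : ℝ) :
    deriv (fun x => Real.exp (c * x) * (deriv φ x - c * φ x)) x =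
      Real.exp (c * x) * (deriv (deriv φ) x - c ^ 2 * φ x) := by
  have h1 : ContDiff ℝ 1 (deriv φ) := ContDiff.deriv' (n := 1) (by rwa [one_add_one_eq_two])
  have hd1 : HasDerivAt (deriv φ) (deriv (deriv φ) x) x :=
    (h1.differentiable one_ne_zero x).hasDerivAt
  have hd0 : HasDerivAt φ (deriv φ x) x := (hφ.differentiable two_ne_zero x).hasDerivAt
  have he : HasDerivAt (fun x => Real.exp (c * x)) (Real.exp (c * x) * (c * 1)) x :=
    ((hasDerivAt_id x).const_mul c).exp
  refine (he.mul (hd1.sub (hd0.const_mul c))).deriv.trans ?_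
  simp only [Pi.sub_apply]
  ring

lemma HasCompactSupport.exp_mul_deriv_sub (hsupp : HasCompactSupport φ) :
    HasCompactSupport (fun x => Real.exp (c * x) * (deriv φ x - c * φ x)) :=
  HasCompactSupport.mul_left (f := fun x => Real.exp (c * x))
    (hsupp.deriv.sub (hsupp.mul_left (f := fun _ => c)))

lemma integral_Ioi_exp_mul (hφ : ContDiff ℝ 2 φ) (hsupp : HasCompactSupport φ) :
    ∫ x in Set.Ioi 0, Real.exp (c * x) * (deriv (deriv φ) x - c ^ 2 * φ x) =
      c * φ 0 - deriv φ 0 := by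
  have h := (hsupp.exp_mul_deriv_sub c).integral_Ioi_deriv_eq (contDiff_exp_mul_deriv_sub c hφ) 0
  simpa [deriv_exp_mul_deriv_sub c hφ] using h

lemma integral_Iic_exp_mul (hφ : ContDiff ℝ 2 φ) (hsupp : HasCompactSupport φ) :
    ∫ x in Set.Iic 0, Real.exp (c * x) * (deriv (deriv φ) x - c ^ 2 * φ x) =
      deriv φ 0 - c * φ 0 := by
  have h := (hsupp.exp_mul_deriv_sub c).integral_Iic_deriv_eq (contDiff_exp_mul_deriv_sub c hφ) 0
  simpa [deriv_exp_mul_deriv_sub c hφ] using h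

end ExpMulAntiderivative

/-- The function `exp (-s|x|)` satisfies `u'' - s² u = -2 s δ` in the sense of distributions. -/
lemma integral_exp_neg_mul_abs_mul (s : ℝ) {φ : ℝ → ℝ} (hφ : ContDiff ℝ 2 φ)
    (hsupp : HasCompactSupport φ) :
    ∫ x : ℝ, Real.exp (-s * |x|) * (deriv (deriv φ) x - s ^ 2 * φ x) = -(2 * s * φ 0) := by
  have h1 : ContDiff ℝ 1 (deriv φ) := ContDiff.deriv' (n := 1) (by rwa [one_add_one_eq_two])
  have h2 : Continuous (deriv (deriv φ)) := h1.continuous_deriv le_rfl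
  have h0 : Continuous φ := hφ.continuous
  have hint : Integrable
      (fun x : ℝ => Real.exp (-s * |x|) * (deriv (deriv φ) x - s ^ 2 * φ x)) :=
    Continuous.integrable_of_hasCompactSupport (by fun_prop)
      (HasCompactSupport.mul_left (f := fun x : ℝ => Real.exp (-s * |x|))
        (hsupp.deriv.deriv.sub (hsupp.mul_left (f := fun _ => s ^ 2))))
  rw [← intervalIntegral.integral_Iic_add_Ioi (b := 0) hint.integrableOn hint.integrableOn]
  have hneg : ∫ x in Set.Iic 0, Real.exp (-s * |x|) * (deriv (deriv φ) x - s ^ 2 * φ x) =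
      deriv φ 0 - s * φ 0 := by
    rw [← integral_Iic_exp_mul s hφ hsupp]
    refine setIntegral_congr_fun measurableSet_Iic fun x hx => ?_
    simp [abs_of_nonpos hx.out]
  have hpos : ∫ x in Set.Ioi 0, Real.exp (-s * |x|) * (deriv (deriv φ) x - s ^ 2 * φ x) =
      -s * φ 0 - deriv φ 0 := by
    rw [← integral_Ioi_exp_mul (-s) hφ hsupp]
    refine setIntegral_congr_fun measurableSet_Ioi fun x hx => ?_
    simp [abs_of_pos hx.out]
  rw [hneg, hpos]
  ring

/-- For `r > 0` and `p(x) = (√r/2)e^(-√r|x|)`, `p` is a distributional stationary solution of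
the diffusion equation with resetting to the origin at rate `r`: for every smooth compactly
supported test function `φ`, `∫ p φ'' - r ∫ p φ + r φ(0) = 0`. -/
theorem laplace_profile_distributional_stationarity (r : ℝ) (hr : 0 < r)
    (φ : ℝ → ℝ) (hφ : ContDiff ℝ (⊤ : ℕ∞) φ) (hsupp : HasCompactSupport φ) :
    (∫ x : ℝ, Real.sqrt r / 2 * Real.exp (-Real.sqrt r * |x|) * deriv (deriv φ) x) -
      r * (∫ x : ℝ, Real.sqrt r / 2 * Real.exp (-Real.sqrt r * |x|) * φ x) +
      r * φ 0 = 0 := by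
  have hφ2 : ContDiff ℝ 2 φ := contDiff_infty.mp hφ 2
  have h1 : ContDiff ℝ 1 (deriv φ) := ContDiff.deriv' (n := 1) (by rwa [one_add_one_eq_two])
  have h2 : Continuous (deriv (deriv φ)) := h1.continuous_deriv le_rfl
  have h0 : Continuous φ := hφ.continuous
  have hs : √r ^ 2 = r := Real.sq_sqrt hr.le
  have hint {ψ : ℝ → ℝ} (hψ : Continuous ψ) (hψs : HasCompactSupport ψ) :
      Integrable (fun x : ℝ => √r / 2 * Real.exp (-√r * |x|) * ψ x) :=
    Continuous.integrable_of_hasCompactSupport (by fun_prop)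
      (HasCompactSupport.mul_left (f := fun x : ℝ => √r / 2 * Real.exp (-√r * |x|)) hψs)
  have key := integral_exp_neg_mul_abs_mul √r hφ2 hsupp
  rw [← integral_const_mul, ← integral_sub (hint h2 hsupp.deriv.deriv)
    ((hint h0 hsupp).const_mul r)]
  have hcongr : ∀ x : ℝ, √r / 2 * Real.exp (-√r * |x|) * deriv (deriv φ) x -
      r * (√r / 2 * Real.exp (-√r * |x|) * φ x) =
      √r / 2 * (Real.exp (-√r * |x|) * (deriv (deriv φ) x - √r ^ 2 * φ x)) := by
    intro x
    rw [hs]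
    ring
  simp_rw [hcongr]
  rw [integral_const_mul, key]
  linear_combination -φ 0 * hs
end

section
/- For every real R > 0, the flux-balance identity R · ∫₀^∞ exp(−Φ²/2) · h_R(Φ/√2) dΦ = Γ((1+R)/2)/√2 holds, where h_R(x) = ∫₀^∞ t^(R−1) exp(−t² − 2xt) dt. This expresses that the total probability lost to resetting from the positive half-line equals the probability current injected at the origin for the high-temperature stationary profile P(Φ) = e^{−Φ²/2}h_R(Φ/√2). -/
open Real MeasureTheory

/-- The density `t^(R-1) e^(-s²)` on the wedge `0 < t < s`, extended by zero to the plane. -/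
noncomputable def wedgeDensity (R : ℝ) : ℝ × ℝ → ℝ :=
  {p : ℝ × ℝ | 0 < p.2 ∧ p.2 < p.1}.indicator fun p ↦ p.2 ^ (R - 1) * Real.exp (-p.1 ^ 2)

lemma measurable_wedgeDensity (R : ℝ) : Measurable (wedgeDensity R) := by
  refine Measurable.indicator (by fun_prop) ?_
  exact (measurableSet_lt measurable_const measurable_snd).inter
    (measurableSet_lt measurable_snd measurable_fst)

lemma wedgeDensity_nonneg (R : ℝ) (p : ℝ × ℝ) : 0 ≤ wedgeDensity R p :=
  Set.indicator_nonneg (fun _ hp ↦ mul_nonneg (rpow_nonneg hp.1.le _) (exp_nonneg _)) p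

lemma wedgeDensity_section (R s : ℝ) :
    (fun t ↦ wedgeDensity R (s, t)) =
      (Set.Ioo 0 s).indicator fun t ↦ t ^ (R - 1) * Real.exp (-s ^ 2) := rfl

lemma integrable_wedgeDensity_section {R : ℝ} (hR : 0 < R) (s : ℝ) :
    Integrable fun t ↦ wedgeDensity R (s, t) := by
  rw [wedgeDensity_section, integrable_indicator_iff measurableSet_Ioo]
  refine Integrable.mul_const ?_ _
  rcases le_or_gt s 0 with hs | hs
  · simp [hs]
  · exact (intervalIntegral.integrableOn_Ioo_rpow_iff hs).2 (by linarith)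

lemma integral_wedgeDensity_section {R : ℝ} (hR : 0 < R) (s : ℝ) :
    ∫ t, wedgeDensity R (s, t) =
      (Set.Ioi 0).indicator (fun s ↦ R⁻¹ * (s ^ R * Real.exp (-s ^ 2))) s := by
  rw [wedgeDensity_section, integral_indicator measurableSet_Ioo, integral_mul_const]
  rcases le_or_gt s 0 with hs | hs
  · simp [hs]
  · rw [← integral_Ioc_eq_integral_Ioo, ← intervalIntegral.integral_of_le hs.le,
      integral_rpow (Or.inl (by linarith)), Set.indicator_of_mem (Set.mem_Ioi.2 hs),
      sub_add_cancel, zero_rpow hR.ne']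
    ring

lemma integrable_wedgeDensity {R : ℝ} (hR : 0 < R) : Integrable (wedgeDensity R) := by
  rw [Measure.volume_eq_prod,
    integrable_prod_iff (measurable_wedgeDensity R).aestronglyMeasurable]
  refine ⟨.of_forall (integrable_wedgeDensity_section hR), ?_⟩
  simp_rw [Real.norm_of_nonneg (wedgeDensity_nonneg R _), integral_wedgeDensity_section hR]
  rw [integrable_indicator_iff measurableSet_Ioi]
  refine Integrable.const_mul ?_ _
  simpa [IntegrableOn] using
    integrableOn_rpow_mul_exp_neg_mul_sq one_pos (by linarith : -1 < R)

lemma integral_integral_wedgeDensity {R : ℝ} (hR : 0 < R) :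
    ∫ s, ∫ t, wedgeDensity R (s, t) = R⁻¹ * (Real.Gamma ((1 + R) / 2) / 2) := by
  simp_rw [integral_wedgeDensity_section hR]
  rw [integral_indicator measurableSet_Ioi, integral_const_mul]
  have h := integral_rpow_mul_exp_neg_rpow (p := 2) (q := R) two_pos (by linarith)
  simp only [rpow_two] at h
  rw [h, add_comm R 1]
  ring

lemma integral_integral_wedgeDensity_shear {R : ℝ} (hR : 0 < R) :
    ∫ u, ∫ t, wedgeDensity R (u + t, t) = ∫ s, ∫ t, wedgeDensity R (s, t) := by
  have hint : Integrable (fun p : ℝ × ℝ ↦ wedgeDensity R (p.1, p.2))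
      ((volume : Measure ℝ).prod volume) := integrable_wedgeDensity hR
  have hshear : Integrable (fun p : ℝ × ℝ ↦ wedgeDensity R (p.1 + p.2, p.2))
      ((volume : Measure ℝ).prod volume) := by
    have hmeas : Measurable fun p : ℝ × ℝ ↦ wedgeDensity R (p.1 + p.2, p.2) :=
      (measurable_wedgeDensity R).comp (by fun_prop)
    rw [integrable_prod_iff' hmeas.aestronglyMeasurable]
    obtain ⟨h₁, h₂⟩ := (integrable_prod_iff'
      (measurable_wedgeDensity R).aestronglyMeasurable).1 hint
    refine ⟨h₁.mono fun t ht ↦ ht.comp_add_right t, h₂.congr (.of_forall fun t ↦ ?_)⟩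
    exact (integral_add_right_eq_self (fun s ↦ ‖wedgeDensity R (s, t)‖) t).symm
  rw [integral_integral_swap (f := fun u t ↦ wedgeDensity R (u + t, t)) hshear,
    integral_integral_swap (f := fun s t ↦ wedgeDensity R (s, t)) hint]
  congr 1 with t
  exact integral_add_right_eq_self (fun s ↦ wedgeDensity R (s, t)) t

lemma exp_mul_hFun (R u : ℝ) :
    Real.exp (-u ^ 2) * hFun R u =
      ∫ t in Set.Ioi (0 : ℝ), t ^ (R - 1) * Real.exp (-(u + t) ^ 2) := by
  rw [hFun, ← integral_const_mul]
  congr 1 with t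
  rw [mul_left_comm, ← Real.exp_add]
  ring_nf

lemma integral_wedgeDensity_shear_section (R u : ℝ) :
    ∫ t, wedgeDensity R (u + t, t) =
      (Set.Ioi 0).indicator (fun u ↦ Real.exp (-u ^ 2) * hFun R u) u := by
  rcases le_or_gt u 0 with hu | hu
  · simp [wedgeDensity, not_lt.2 hu]
  · rw [Set.indicator_of_mem (Set.mem_Ioi.2 hu), exp_mul_hFun,
      ← integral_indicator measurableSet_Ioi]
    congr 1 with t
    simp [wedgeDensity, Set.indicator_apply, hu]

/-- Flux balance for the high-temperature stationary profile `P(Φ) = e^(-Φ²/2) h_R(Φ/√2)`: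
for every `R > 0`, `R ∫₀^∞ e^(-Φ²/2) h_R(Φ/√2) dΦ = Γ((1+R)/2)/√2`. -/
theorem flux_balance_high_temperature (R : ℝ) (hR : 0 < R) :
    R * ∫ Φ in Set.Ioi (0 : ℝ), Real.exp (-Φ ^ 2 / 2) * hFun R (Φ / Real.sqrt 2) =
      Real.Gamma ((1 + R) / 2) / Real.sqrt 2 := by
  have hs : 0 < (Real.sqrt 2)⁻¹ := by positivity
  have hscale := integral_comp_mul_right_Ioi
    (fun u ↦ Real.exp (-u ^ 2) * hFun R u) 0 hs
  have hprofile : ∀ Φ : ℝ, Real.exp (-Φ ^ 2 / 2) * hFun R (Φ / Real.sqrt 2) =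
      Real.exp (-(Φ * (Real.sqrt 2)⁻¹) ^ 2) * hFun R (Φ * (Real.sqrt 2)⁻¹) := fun Φ ↦ by
    rw [mul_pow, inv_pow, Real.sq_sqrt zero_le_two, div_eq_mul_inv Φ, neg_div, div_eq_mul_inv]
  have hvalue : ∫ u in Set.Ioi (0 : ℝ), Real.exp (-u ^ 2) * hFun R u =
      R⁻¹ * (Real.Gamma ((1 + R) / 2) / 2) := by
    rw [← integral_integral_wedgeDensity hR, ← integral_integral_wedgeDensity_shear hR,
      ← integral_indicator measurableSet_Ioi]
    simp_rw [integral_wedgeDensity_shear_section]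
  simp_rw [hprofile]
  rw [hscale, zero_mul, hvalue, inv_inv, smul_eq_mul]
  field_simp
  rw [Real.sq_sqrt zero_le_two]
end

section
/- For every real R > 0, the flux-balance identity R · ∫₀^∞ k_R(Φ/√2) dΦ = Γ(1 + R/2)/√2 holds, where k_R(x) = ∫₀^∞ t^R exp(−t² − 2xt) dt. This expresses that the total probability lost to resetting from the positive half-line equals the probability current injected at the origin for the low-temperature stationary profile P(Φ) = k_R(Φ/√2). -/
open Real MeasureTheory

/-- `kFun R x = ∫₀^∞ t^R exp(-t² - 2xt) dt`, i.e. `Γ(1+R) · H(-1-R, x)`. -/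
noncomputable def kFun (R x : ℝ) : ℝ :=
  ∫ t in Set.Ioi (0 : ℝ), t ^ R * Real.exp (-t ^ 2 - 2 * x * t)

theorem integral_kFun_integrand_Ioi (R : ℝ) {t : ℝ} (ht : 0 < t) :
    ∫ x in Set.Ioi (0 : ℝ), t ^ R * Real.exp (-t ^ 2 - 2 * x * t) =
      t ^ (R - 1) * Real.exp (-t ^ (2 : ℝ)) / 2 := by
  have h (x : ℝ) : t ^ R * Real.exp (-t ^ 2 - 2 * x * t) =
      t ^ R * Real.exp (-t ^ 2) * Real.exp (-(2 * t) * x) := by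
    rw [mul_assoc (t ^ R), ← Real.exp_add]
    ring_nf
  simp_rw [h]
  rw [integral_const_mul, integral_exp_mul_Ioi (by linarith), Real.rpow_sub_one ht.ne',
    Real.rpow_two]
  simp only [mul_zero, Real.exp_zero]
  field_simp

theorem integrable_kFun_integrand {R : ℝ} (hR : 0 < R) :
    Integrable (Function.uncurry fun x t : ℝ => t ^ R * Real.exp (-t ^ 2 - 2 * x * t))
      ((volume.restrict (Set.Ioi 0)).prod (volume.restrict (Set.Ioi 0))) := by
  have hmeas : Measurable
      (Function.uncurry fun x t : ℝ => t ^ R * Real.exp (-t ^ 2 - 2 * x * t)) := by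
    unfold Function.uncurry
    fun_prop
  rw [integrable_prod_iff' hmeas.aestronglyMeasurable]
  constructor
  · filter_upwards [ae_restrict_mem measurableSet_Ioi] with t ht
    have ht : 0 < t := ht
    refine ((integrableOn_exp_mul_Ioi (a := -(2 * t)) (by linarith) 0).const_mul
      (t ^ R * Real.exp (-t ^ 2))).congr (.of_forall fun x => ?_)
    simp only [Function.uncurry]
    rw [mul_assoc (t ^ R), ← Real.exp_add]
    ring_nf
  · refine ((integrableOn_rpow_mul_exp_neg_rpow (s := R - 1) (p := 2)
      (by linarith) (by norm_num)).div_const 2).congr ?_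
    filter_upwards [ae_restrict_mem measurableSet_Ioi] with t ht
    have ht : 0 < t := ht
    rw [← integral_kFun_integrand_Ioi R ht]
    refine integral_congr_ae (.of_forall fun x => ?_)
    exact (Real.norm_of_nonneg (by dsimp only; positivity)).symm

theorem integral_kFun_Ioi {R : ℝ} (hR : 0 < R) :
    ∫ x in Set.Ioi (0 : ℝ), kFun R x = Real.Gamma (R / 2) / 4 := by
  unfold kFun
  rw [integral_integral_swap (integrable_kFun_integrand hR),
    setIntegral_congr_fun measurableSet_Ioi fun t ht => integral_kFun_integrand_Ioi R ht,
    integral_div, integral_rpow_mul_exp_neg_rpow (by norm_num) (by linarith), sub_add_cancel]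
  ring

/-- Flux balance for the low-temperature stationary profile `P(Φ) = k_R(Φ/√2)`:
for every `R > 0`, `R ∫₀^∞ k_R(Φ/√2) dΦ = Γ(1+R/2)/√2`. -/
theorem flux_balance_low_temperature (R : ℝ) (hR : 0 < R) :
    R * ∫ Φ in Set.Ioi (0 : ℝ), kFun R (Φ / Real.sqrt 2) =
      Real.Gamma (1 + R / 2) / Real.sqrt 2 := by
  have hscale := integral_comp_mul_right_Ioi (kFun R) 0 (b := (√2)⁻¹) (by positivity)
  simp only [← div_eq_mul_inv, zero_div, inv_inv, smul_eq_mul] at hscale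
  rw [hscale, integral_kFun_Ioi hR, add_comm, Real.Gamma_add_one (by positivity)]
  field_simp
  rw [Real.sq_sqrt (by norm_num)]
  ring
end
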